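/- Fix 1 < p < ∞, let φ be a non-trivial weight on (0, ∞), and set ρ := ρ_{p,φ}. Then there exist constants c, C > 0 such that for all t > 0: c·A(t) ≤ h_ρ(t) ≤ C·A(t) and c·A(t) ≤ M_ρ(t) ≤ C·A(t), where A(t) := sup_{s>0} [(∫₀^{st} φ(y) dy + sᵖtᵖ ∫_{st}^∞ φ(y) y^{-p} dy)/(∫₀^{s} φ(y) dy + sᵖ ∫_{s}^∞ φ(y) y^{-p} dy)]^{1/p}; in particular h_ρ(t) ≈ M_ρ(t) uniformly in t > 0. -/

import Mathlib

open MeasureTheory Set ENNReal Filter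

noncomputable section

/-- The interval `I_b = (0, b)` for `b ∈ (0, ∞]`, as a subset of `ℝ`. -/
def IbSet (b : ℝ≥0∞) : Set ℝ := {t : ℝ | 0 < t ∧ ENNReal.ofReal t < b}

/-- `∫₀ᵗ φ`. -/
def intPhi (φ : ℝ → ℝ≥0∞) (t : ℝ) : ℝ≥0∞ := ∫⁻ s in Ioo (0 : ℝ) t, φ s

/-- `∫ₜᵇ φ(s) s^(-p) ds`. -/
def tailP (b : ℝ≥0∞) (p : ℝ) (φ : ℝ → ℝ≥0∞) (t : ℝ) : ℝ≥0∞ :=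
  ∫⁻ s in {s : ℝ | t < s ∧ ENNReal.ofReal s < b}, φ s * ENNReal.ofReal (s ^ (-p))

/-- `∫₀ᵗ φ + tᵖ ∫ₜᵇ φ(s) s^(-p) ds`. -/
def DPhi (b : ℝ≥0∞) (p : ℝ) (φ : ℝ → ℝ≥0∞) (t : ℝ) : ℝ≥0∞ :=
  intPhi φ t + ENNReal.ofReal (t ^ p) * tailP b p φ t

/-- The Hardy averaging operator `P`. -/
def Pavg (g : ℝ → ℝ≥0∞) (t : ℝ) : ℝ≥0∞ := (ENNReal.ofReal t)⁻¹ * ∫⁻ s in Ioo (0 : ℝ) t, g s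

/-- The dual Hardy operator `Q`, `(Qg)(t) = ∫ₜᵇ g(s) s⁻¹ ds`. -/
def Qavg (b : ℝ≥0∞) (g : ℝ → ℝ≥0∞) (t : ℝ) : ℝ≥0∞ :=
  ∫⁻ s in {s : ℝ | t < s ∧ ENNReal.ofReal s < b}, g s * (ENNReal.ofReal s)⁻¹

/-- The operator `Q_p`, `(Q_p g)(t) = p t^(p-1) ∫ₜᵇ g(s) s^(-p) ds`. -/
def Qp (b : ℝ≥0∞) (p : ℝ) (g : ℝ → ℝ≥0∞) (t : ℝ) : ℝ≥0∞ :=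
  ENNReal.ofReal (p * t ^ (p - 1)) *
    ∫⁻ s in {s : ℝ | t < s ∧ ENNReal.ofReal s < b}, g s * ENNReal.ofReal (s ^ (-p))

/-- `(PQ_p)(φ)(t) = t⁻¹ [∫₀ᵗ φ + tᵖ ∫ₜᵇ φ(s) s^(-p) ds]`. -/
def PQp (b : ℝ≥0∞) (p : ℝ) (φ : ℝ → ℝ≥0∞) (t : ℝ) : ℝ≥0∞ :=
  (ENNReal.ofReal t)⁻¹ * DPhi b p φ t

/-- A weight on `I_b`: a positive, finite, locally integrable function. -/
def IsWeight (b : ℝ≥0∞) (φ : ℝ → ℝ≥0∞) : Prop :=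
  Measurable φ ∧ (∀ t ∈ IbSet b, 0 < φ t ∧ φ t < ⊤) ∧
    ∀ a c : ℝ, 0 < a → ENNReal.ofReal c < b → ∫⁻ t in Icc a c, φ t < ⊤

/-- A non-trivial weight on `I_b` for the index `p`. -/
def IsNontrivialWeight (b : ℝ≥0∞) (p : ℝ) (φ : ℝ → ℝ≥0∞) : Prop :=
  IsWeight b φ ∧
    (b = ⊤ → ∫⁻ t in Ioi (1 : ℝ), φ t * ENNReal.ofReal (t ^ (-p)) < ⊤) ∧
    tailP b p φ 0 = ⊤

/-- The dual weight `ψ(t) = t^(p+p'-1) (∫₀ᵗ φ)(∫ₜᵇ φ(s)s^(-p) ds)/D(t)^(p'+1)`. -/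
def dualWeight (b : ℝ≥0∞) (p : ℝ) (φ : ℝ → ℝ≥0∞) (t : ℝ) : ℝ≥0∞ :=
  ENNReal.ofReal (t ^ (p + p / (p - 1) - 1)) * intPhi φ t * tailP b p φ t /
    (DPhi b p φ t) ^ (p / (p - 1) + 1)

/-- `ψ = (Pφ)(Q_pφ)/[(PQ_p)(φ)]^(p'+1)`. -/
def dualWeight' (b : ℝ≥0∞) (p : ℝ) (φ : ℝ → ℝ≥0∞) (t : ℝ) : ℝ≥0∞ :=
  Pavg φ t * Qp b p φ t / (PQp b p φ t) ^ (p / (p - 1) + 1)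

/-- The decreasing rearrangement `f*`. -/
def decRearr {α : Type*} [MeasurableSpace α] (μ : Measure α) (f : α → ℝ) (t : ℝ) : ℝ≥0∞ :=
  sInf {l : ℝ≥0∞ | μ {x | l < (‖f x‖₊ : ℝ≥0∞)} ≤ ENNReal.ofReal t}

/-- `f**(t) = t⁻¹ ∫₀ᵗ f*`. -/
def avgRearr {α : Type*} [MeasurableSpace α] (μ : Measure α) (f : α → ℝ) (t : ℝ) : ℝ≥0∞ :=
  (ENNReal.ofReal t)⁻¹ * ∫⁻ s in Ioo (0 : ℝ) t, decRearr μ f s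

/-- The Lorentz Gamma functional `ρ_{p,φ}(f) = (∫_{I_b} f**(t)^p φ(t) dt)^(1/p)`. -/
def rhoGamma {α : Type*} [MeasurableSpace α] (μ : Measure α) (b : ℝ≥0∞) (p : ℝ)
    (φ : ℝ → ℝ≥0∞) (f : α → ℝ) : ℝ≥0∞ :=
  (∫⁻ t in IbSet b, (avgRearr μ f t) ^ p * φ t) ^ (1 / p)

/-- The Stieltjes operator `(Sg)(t) = ∫₀^∞ g(s)/(s+t) ds`. -/
def Sop (g : ℝ → ℝ≥0∞) (t : ℝ) : ℝ≥0∞ :=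
  ∫⁻ s in Ioi (0 : ℝ), g s / ENNReal.ofReal (s + t)

/-- Lebesgue measure on `(0,∞)`. -/
def mu0 : Measure ℝ := volume.restrict (Ioi (0 : ℝ))

/-- The dilation function `h_ρ`. -/
def hRho (p : ℝ) (φ : ℝ → ℝ≥0∞) (t : ℝ) : ℝ≥0∞ :=
  ⨆ (f : ℝ → ℝ) (_ : Measurable f) (_ : ∀ x, 0 ≤ f x) (_ : ¬ f =ᵐ[mu0] 0),
    rhoGamma mu0 ⊤ p φ (fun s => f (s / t)) / rhoGamma mu0 ⊤ p φ f

/-- The fundamental function quotient `M_ρ`. -/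
def MRho (p : ℝ) (φ : ℝ → ℝ≥0∞) (t : ℝ) : ℝ≥0∞ :=
  ⨆ (a : ℝ) (_ : 0 < a),
    rhoGamma mu0 ⊤ p φ ((Ioo (0 : ℝ) (a * t)).indicator fun _ => (1 : ℝ)) /
      rhoGamma mu0 ⊤ p φ ((Ioo (0 : ℝ) a).indicator fun _ => (1 : ℝ))

/-- The explicit expression `A(t)` of Theorem B. -/
def ABoyd (p : ℝ) (φ : ℝ → ℝ≥0∞) (t : ℝ) : ℝ≥0∞ :=
  ⨆ (s : ℝ) (_ : 0 < s),
    ((intPhi φ (s * t) + ENNReal.ofReal (s ^ p * t ^ p) * tailP ⊤ p φ (s * t)) /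
      (intPhi φ s + ENNReal.ofReal (s ^ p) * tailP ⊤ p φ s)) ^ (1 / p)

/-! ### Preliminaries on antitone functions and Hardy averages -/

lemma aux_const_le {g : ℝ → ℝ≥0∞} (hg : Antitone g) {u : ℝ} :
    ENNReal.ofReal u * g u ≤ ∫⁻ s in Ioo (0 : ℝ) u, g s := by
  calc ENNReal.ofReal u * g u = ∫⁻ s in Ioo (0 : ℝ) u, g u := by
        rw [setLIntegral_const, Real.volume_Ioo, sub_zero, mul_comm]
    _ ≤ _ := setLIntegral_mono' measurableSet_Ioo (fun s hs => hg hs.2.le)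

lemma aux_lt_top {g : ℝ → ℝ≥0∞} (hg : Antitone g)
    (hfin : ∀ u, ∫⁻ s in Ioo (0 : ℝ) u, g s ≠ ⊤) {u : ℝ} (hu : 0 < u) : g u ≠ ⊤ := by
  intro h
  have := aux_const_le hg (u := u)
  rw [h, ENNReal.mul_top (by simpa using hu)] at this
  exact hfin u (top_le_iff.mp this)

lemma aux_ftc {g : ℝ → ℝ≥0∞} (hg : Antitone g) {p : ℝ} (hp : 1 < p)
    (hfin : ∀ u, ∫⁻ s in Ioo (0 : ℝ) u, g s ≠ ⊤) {u : ℝ} (hu : 0 < u) :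
    (∫⁻ s in Ioo (0 : ℝ) u, g s) ^ p =
      ∫⁻ s in Ioo (0 : ℝ) u, ENNReal.ofReal p * (∫⁻ r in Ioo (0 : ℝ) s, g r) ^ (p - 1) * g s := by
  have hgm : Measurable g := hg.measurable
  set G : ℝ → ℝ := fun s => (g s).toReal with hG
  have hint : ∀ v, 0 ≤ v → IntegrableOn G (Icc 0 v) := by
    intro v hv
    rw [integrableOn_Icc_iff_integrableOn_Ioo]
    exact integrable_toReal_of_lintegral_ne_top hgm.aemeasurable (hfin v)
  have hii : ∀ v, 0 ≤ v → IntervalIntegrable G volume 0 v := fun v hv =>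
    (intervalIntegrable_iff_integrableOn_Icc_of_le hv).mpr (hint v hv)
  set F : ℝ → ℝ := fun s => ∫ x in (0 : ℝ)..s, G x with hF
  have hF0 : ∀ s, 0 ≤ s → 0 ≤ F s := fun s hs =>
    intervalIntegral.integral_nonneg hs (fun _ _ => ENNReal.toReal_nonneg)
  have hFe : ∀ s, 0 ≤ s → ∫⁻ r in Ioo (0 : ℝ) s, g r = ENNReal.ofReal (F s) := by
    intro s hs
    rw [hF]
    simp only
    rw [intervalIntegral.integral_of_le hs, integral_Ioc_eq_integral_Ioo,
      integral_toReal hgm.aemeasurable, ENNReal.ofReal_toReal (hfin s)]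
    filter_upwards [ae_restrict_mem measurableSet_Ioo] with x hx
    exact (aux_lt_top hg hfin hx.1).lt_top
  have hcont : ContinuousOn F (Icc 0 u) := by
    have := intervalIntegral.continuousOn_primitive_interval (f := G) (a := 0) (b := u) (μ := volume)
      (by rw [uIcc_of_le hu.le]; exact hint u hu.le)
    rwa [uIcc_of_le hu.le] at this
  have hI : IntegrableOn (fun s => p * F s ^ (p - 1) * G s) (Icc 0 u) := by
    apply IntegrableOn.continuousOn_mul _ (hint u hu.le) isCompact_Icc
    exact continuousOn_const.mul (hcont.rpow_const (fun x hx => Or.inr (by linarith)))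
  have key := integral_eq_of_hasDerivAt_off_countable_of_le (fun s => F s ^ p)
    (fun s => p * F s ^ (p - 1) * G s) hu.le hg.countable_not_continuousAt
    (hcont.rpow_const (fun x hx => Or.inr (by linarith)))
    (by
      rintro x ⟨hx, hxc⟩
      have hxc : ContinuousAt g x := by simpa using hxc
      have hGc : ContinuousAt G x :=
        (ENNReal.tendsto_toReal (aux_lt_top hg hfin hx.1)).comp hxc
      have h1 : HasDerivAt F (G x) x := intervalIntegral.integral_hasDerivAt_right (hii x hx.1.le)
        (hgm.ennreal_toReal.stronglyMeasurable.stronglyMeasurableAtFilter) hGc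
      have := h1.rpow_const (p := p) (Or.inr hp.le)
      exact this.congr_deriv (by ring))
    ((intervalIntegrable_iff_integrableOn_Icc_of_le hu.le).mpr hI)
  have hF00 : F 0 = 0 := by simp [hF]
  rw [hF00, Real.zero_rpow (by linarith), sub_zero, intervalIntegral.integral_of_le hu.le,
    integral_Ioc_eq_integral_Ioo] at key
  rw [hFe u hu.le, ENNReal.ofReal_rpow_of_nonneg (hF0 u hu.le) (by linarith), ← key,
    ofReal_integral_eq_lintegral_ofReal (hI.mono_set Ioo_subset_Icc_self)]
  · apply setLIntegral_congr_fun measurableSet_Ioo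
    intro s hs
    have := hF0 s hs.1.le
    simp only
    rw [hFe s hs.1.le, ENNReal.ofReal_rpow_of_nonneg this (by linarith),
      ENNReal.ofReal_mul (by positivity), ENNReal.ofReal_mul (by linarith),
      ENNReal.ofReal_toReal (aux_lt_top hg hfin hs.1)]
  · filter_upwards [ae_restrict_mem measurableSet_Ioo] with s hs
    have := hF0 s hs.1.le
    have : 0 ≤ G s := ENNReal.toReal_nonneg
    simp only [Pi.zero_apply]
    positivity

lemma aux_ofReal_mul_Pavg (g : ℝ → ℝ≥0∞) {u : ℝ} (hu : 0 < u) :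
    ENNReal.ofReal u * Pavg g u = ∫⁻ s in Ioo (0 : ℝ) u, g s := by
  rw [Pavg, ← mul_assoc, ENNReal.mul_inv_cancel (by simpa using hu) ENNReal.ofReal_ne_top, one_mul]

lemma aux_le_Pavg {g : ℝ → ℝ≥0∞} (hg : Antitone g) {u : ℝ} (hu : 0 < u) : g u ≤ Pavg g u := by
  have h := aux_const_le hg (u := u)
  rw [← aux_ofReal_mul_Pavg g hu] at h
  exact (ENNReal.mul_le_mul_iff_right (by simpa using hu) ENNReal.ofReal_ne_top).mp h

lemma aux_Pavg_anti {g : ℝ → ℝ≥0∞} (hg : Antitone g) {u v : ℝ} (hu : 0 < u) (huv : u ≤ v) :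
    Pavg g v ≤ Pavg g u := by
  have hv : 0 < v := hu.trans_le huv
  refine (ENNReal.mul_le_mul_iff_right (a := ENNReal.ofReal v) (by simpa using hv)
    ENNReal.ofReal_ne_top).mp ?_
  rw [aux_ofReal_mul_Pavg g hv]
  have hun : Ioo (0 : ℝ) v ⊆ Ioo 0 u ∪ Icc u v := by
    intro x hx
    rcases lt_or_ge x u with h | h
    · exact Or.inl ⟨hx.1, h⟩
    · exact Or.inr ⟨h, hx.2.le⟩
  calc ∫⁻ s in Ioo (0 : ℝ) v, g s ≤ ∫⁻ s in Ioo 0 u ∪ Icc u v, g s := lintegral_mono_set hun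
    _ ≤ (∫⁻ s in Ioo 0 u, g s) + ∫⁻ s in Icc u v, g s := lintegral_union_le _ _ _
    _ ≤ ENNReal.ofReal u * Pavg g u + ENNReal.ofReal (v - u) * Pavg g u := by
        rw [aux_ofReal_mul_Pavg g hu]
        gcongr
        calc ∫⁻ s in Icc u v, g s ≤ ∫⁻ s in Icc u v, Pavg g u :=
              setLIntegral_mono' measurableSet_Icc
                (fun s hs => (hg hs.1).trans (aux_le_Pavg hg hu))
          _ = _ := by rw [setLIntegral_const, Real.volume_Icc, mul_comm]
    _ = ENNReal.ofReal v * Pavg g u := by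
        rw [← add_mul, ← ENNReal.ofReal_add hu.le (by linarith)]
        congr 2
        ring

lemma aux_decRearr_anti (f : ℝ → ℝ) : Antitone (decRearr mu0 f) := by
  intro a b hab
  apply sInf_le_sInf
  intro l hl
  exact le_trans hl (ENNReal.ofReal_le_ofReal hab)

lemma aux_decRearr_dil (f : ℝ → ℝ) {t : ℝ} (ht : 0 < t) (y : ℝ) :
    decRearr mu0 (fun s => f (s / t)) y = decRearr mu0 f (y / t) := by
  unfold decRearr
  congr 1
  ext l
  simp only [mem_ofPred_eq]
  have h : mu0 {x | l < (‖f (x / t)‖₊ : ℝ≥0∞)} =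
      ENNReal.ofReal t * mu0 {x | l < (‖f x‖₊ : ℝ≥0∞)} := by
    unfold mu0
    rw [Measure.restrict_apply' measurableSet_Ioi, Measure.restrict_apply' measurableSet_Ioi]
    have := Real.volume_preimage_mul_left (a := t⁻¹) (by positivity)
      ({x | l < (‖f x‖₊ : ℝ≥0∞)} ∩ Ioi 0)
    rw [inv_inv, abs_of_pos ht] at this
    rw [← this]
    congr 1
    ext x
    simp only [mem_inter_iff, mem_ofPred_eq, mem_Ioi, mem_preimage]
    rw [div_eq_inv_mul, mul_pos_iff_of_pos_left (inv_pos.mpr ht)]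
  have h2 : ENNReal.ofReal y = ENNReal.ofReal t * ENNReal.ofReal (y / t) := by
    rw [← ENNReal.ofReal_mul ht.le]
    congr 1
    field_simp
  rw [h, h2]
  exact ENNReal.mul_le_mul_iff_right (by simpa using ht) ENNReal.ofReal_ne_top

lemma aux_Pavg_dil {g : ℝ → ℝ≥0∞} (hg : Measurable g) {t : ℝ} (ht : 0 < t) {y : ℝ} (hy : 0 < y) :
    Pavg (fun s => g (s / t)) y = Pavg g (y / t) := by
  have h : ∫⁻ s in Ioo (0 : ℝ) y, g (s / t) =
      ENNReal.ofReal t * ∫⁻ s in Ioo (0 : ℝ) (y / t), g s := by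
    rw [← lintegral_indicator measurableSet_Ioo, ← lintegral_indicator measurableSet_Ioo]
    nth_rewrite 2 [← Real.smul_map_volume_mul_left (a := t⁻¹) (by positivity)]
    rw [lintegral_smul_measure, lintegral_map (hg.indicator measurableSet_Ioo) (by fun_prop),
      smul_eq_mul, ← mul_assoc, ← ENNReal.ofReal_mul ht.le, abs_of_pos (by positivity),
      mul_inv_cancel₀ ht.ne', ENNReal.ofReal_one, one_mul]
    congr 1
    ext x
    simp only [indicator, mem_Ioo, ← div_eq_inv_mul, div_pos_iff_of_pos_right ht,
      div_lt_div_iff_of_pos_right ht]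
  unfold Pavg
  rw [h, ← mul_assoc]
  congr 1
  rw [← ENNReal.ofReal_inv_of_pos hy, ← ENNReal.ofReal_inv_of_pos (by positivity),
    ← ENNReal.ofReal_mul (by positivity)]
  congr 1
  field_simp

lemma aux_avg_dil (f : ℝ → ℝ) {t : ℝ} (ht : 0 < t) {y : ℝ} (hy : 0 < y) :
    avgRearr mu0 (fun s => f (s / t)) y = Pavg (decRearr mu0 f) (y / t) := by
  rw [← aux_Pavg_dil (aux_decRearr_anti f).measurable ht hy]
  unfold avgRearr Pavg
  simp_rw [aux_decRearr_dil f ht]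

/-! ### The kernel and the fundamental function -/

/-- The kernel `min(1, σ/u)^p`. -/
def auxKern (p σ u : ℝ) : ℝ≥0∞ := ENNReal.ofReal ((min u σ / u) ^ p)

lemma aux_IbSet_top : IbSet ⊤ = Ioi 0 := by
  ext x; simp [IbSet]

lemma aux_tail_top (p : ℝ) (φ : ℝ → ℝ≥0∞) (t : ℝ) :
    tailP ⊤ p φ t = ∫⁻ s in Ioi t, φ s * ENNReal.ofReal (s ^ (-p)) := by
  unfold tailP
  congr 2
  ext x; simp

lemma aux_D_eq {p : ℝ} (φ : ℝ → ℝ≥0∞) (hφ : Measurable φ) {a : ℝ} (ha : 0 < a) :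
    ∫⁻ u in Ioi (0 : ℝ), auxKern p a u * φ u = DPhi ⊤ p φ a := by
  have hun : Ioi (0 : ℝ) = Ioc 0 a ∪ Ioi a := (Ioc_union_Ioi_eq_Ioi ha.le).symm
  rw [hun, lintegral_union measurableSet_Ioi (by
    rw [Set.disjoint_left]; intro x hx hx'; exact absurd hx.2 (not_le.mpr hx'))]
  unfold DPhi
  congr 1
  · unfold intPhi
    rw [setLIntegral_congr Ioo_ae_eq_Ioc]
    apply setLIntegral_congr_fun measurableSet_Ioc
    intro u hu
    simp only [auxKern]
    rw [min_eq_left hu.2, div_self hu.1.ne', Real.one_rpow, ENNReal.ofReal_one, one_mul]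
  · rw [aux_tail_top, ← lintegral_const_mul _ (by fun_prop)]
    apply setLIntegral_congr_fun measurableSet_Ioi
    intro u hu
    have hu0 : 0 < u := ha.trans hu
    simp only [auxKern]
    rw [min_eq_right (le_of_lt hu), Real.div_rpow ha.le hu0.le, div_eq_mul_inv,
      ← Real.rpow_neg hu0.le, ENNReal.ofReal_mul (by positivity)]
    ring

lemma aux_decRearr_ind {a s : ℝ} (ha : 0 < a) (hs : 0 < s) :
    decRearr mu0 ((Ioo (0 : ℝ) a).indicator fun _ => (1 : ℝ)) s =
      (Ioo (0 : ℝ) a).indicator (fun _ => (1 : ℝ≥0∞)) s := by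
  have hset : ∀ l : ℝ≥0∞, l < 1 →
      {x | l < (‖(Ioo (0 : ℝ) a).indicator (fun _ => (1 : ℝ)) x‖₊ : ℝ≥0∞)} = Ioo 0 a := by
    intro l hl
    ext x
    by_cases hx : x ∈ Ioo 0 a
    · simp only [mem_ofPred_eq, indicator_of_mem hx, hx, iff_true]
      simpa using hl
    · simp only [mem_ofPred_eq, indicator_of_notMem hx, hx, iff_false]
      simp
  have hmu : mu0 (Ioo 0 a) = ENNReal.ofReal a := by
    unfold mu0
    rw [Measure.restrict_apply measurableSet_Ioo, inter_eq_left.mpr Ioo_subset_Ioi_self,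
      Real.volume_Ioo, sub_zero]
  unfold decRearr
  by_cases h : s < a
  · rw [indicator_of_mem (show s ∈ Ioo 0 a from ⟨hs, h⟩)]
    apply le_antisymm
    · apply sInf_le
      have : {x | (1 : ℝ≥0∞) < (‖(Ioo (0 : ℝ) a).indicator (fun _ => (1 : ℝ)) x‖₊ : ℝ≥0∞)} = ∅ := by
        ext x
        by_cases hx : x ∈ Ioo 0 a
        · simp only [mem_ofPred_eq, indicator_of_mem hx]; simp
        · simp only [mem_ofPred_eq, indicator_of_notMem hx]; simp
      simp only [mem_ofPred_eq]
      rw [this]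
      simp
    · apply le_sInf
      intro l hl
      by_contra hl1
      rw [mem_ofPred_eq, hset l (not_le.mp hl1), hmu, ENNReal.ofReal_le_ofReal_iff hs.le] at hl
      linarith
  · rw [indicator_of_notMem (fun hh => h hh.2)]
    apply le_antisymm _ zero_le
    apply sInf_le
    rw [mem_ofPred_eq, hset 0 one_pos, hmu]
    exact ENNReal.ofReal_le_ofReal (not_lt.mp h)

lemma aux_rho_ind {p : ℝ} (hp : 1 < p) (φ : ℝ → ℝ≥0∞) (hφ : Measurable φ) {a : ℝ} (ha : 0 < a) :
    rhoGamma mu0 ⊤ p φ ((Ioo (0 : ℝ) a).indicator fun _ => (1 : ℝ)) = DPhi ⊤ p φ a ^ (1 / p) := by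
  unfold rhoGamma
  rw [aux_IbSet_top, ← aux_D_eq φ hφ ha]
  congr 1
  apply setLIntegral_congr_fun measurableSet_Ioi
  intro u hu
  have hu : 0 < u := hu
  simp only
  congr 1
  unfold avgRearr auxKern
  rw [setLIntegral_congr_fun (g := (Ioo (0 : ℝ) a).indicator (fun _ => (1 : ℝ≥0∞)))
    measurableSet_Ioo (fun s hs => aux_decRearr_ind ha hs.1),
    setLIntegral_indicator measurableSet_Ioo, setLIntegral_const, one_mul, Ioo_inter_Ioo,
    Real.volume_Ioo, max_self, sub_zero, ← ENNReal.ofReal_inv_of_pos hu,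
    ← ENNReal.ofReal_mul (by positivity), ENNReal.ofReal_rpow_of_nonneg _ (by linarith)]
  · rw [min_comm, inv_mul_eq_div]
  · positivity

lemma aux_A_eq (p : ℝ) (φ : ℝ → ℝ≥0∞) {t : ℝ} (ht : 0 < t) :
    ABoyd p φ t = ⨆ (s : ℝ) (_ : 0 < s), (DPhi ⊤ p φ (s * t) / DPhi ⊤ p φ s) ^ (1 / p) := by
  unfold ABoyd
  refine iSup_congr fun s => iSup_congr fun hs => ?_
  rw [← Real.mul_rpow hs.le ht.le]
  rfl

lemma aux_M_eq {p : ℝ} (hp : 1 < p) (φ : ℝ → ℝ≥0∞) (hφ : Measurable φ) {t : ℝ} (ht : 0 < t) :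
    MRho p φ t = ABoyd p φ t := by
  rw [aux_A_eq p φ ht]
  unfold MRho
  refine iSup_congr fun s => iSup_congr fun hs => ?_
  rw [aux_rho_ind hp φ hφ (by positivity), aux_rho_ind hp φ hφ hs,
    ENNReal.div_rpow_of_nonneg _ _ (by positivity)]

lemma aux_M_le_h (p : ℝ) (φ : ℝ → ℝ≥0∞) {t : ℝ} (ht : 0 < t) :
    MRho p φ t ≤ hRho p φ t := by
  unfold MRho
  refine iSup_le fun a => iSup_le fun ha => ?_
  unfold hRho
  have hd : ((Ioo (0 : ℝ) (a * t)).indicator fun _ => (1 : ℝ)) =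
      fun s => (Ioo (0 : ℝ) a).indicator (fun _ => (1 : ℝ)) (s / t) := by
    ext x
    simp only [indicator, mem_Ioo, div_pos_iff_of_pos_right ht, div_lt_iff₀ ht]
  rw [hd]
  refine le_iSup_of_le ((Ioo (0 : ℝ) a).indicator (fun _ => (1 : ℝ))) ?_
  refine le_iSup_of_le (measurable_const.indicator measurableSet_Ioo) ?_
  refine le_iSup_of_le (fun x => indicator_nonneg (fun _ _ => zero_le_one) x) ?_
  refine le_iSup_of_le ?_ le_rfl
  intro h
  have h2 : ∀ᵐ x ∂mu0, x ∉ Ioo 0 a := by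
    filter_upwards [h] with x hx hxa
    simp [indicator_of_mem hxa] at hx
  rw [ae_iff] at h2
  simp only [not_not] at h2
  unfold mu0 at h2
  rw [show {x | x ∈ Ioo 0 a} = Ioo 0 a from rfl, Measure.restrict_apply measurableSet_Ioo,
    inter_eq_left.mpr Ioo_subset_Ioi_self,
      Real.volume_Ioo, sub_zero] at h2
  simp at h2
  linarith

/-! ### Layer-cake representation -/

/-- `∫_{E ∩ (0,u)} d(s^p) / u^p`. -/
def auxKap (p : ℝ) (E : Set ℝ) (u : ℝ) : ℝ≥0∞ :=
  ENNReal.ofReal (u ^ (-p)) *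
    ∫⁻ s in Ioo (0 : ℝ) u, ENNReal.ofReal (p * s ^ (p - 1)) * E.indicator (fun _ => 1) s

lemma aux_pow_int {p : ℝ} (hp : 1 < p) {u : ℝ} (hu : 0 ≤ u) :
    ∫⁻ s in Ioo (0 : ℝ) u, ENNReal.ofReal (p * s ^ (p - 1)) = ENNReal.ofReal (u ^ p) := by
  have h := integral_rpow (a := 0) (b := u) (r := p - 1) (Or.inl (by linarith))
  have hi : IntervalIntegrable (fun s : ℝ => s ^ (p - 1)) volume 0 u :=
    intervalIntegral.intervalIntegrable_rpow' (by linarith)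
  rw [← ofReal_integral_eq_lintegral_ofReal]
  · rw [← integral_Ioc_eq_integral_Ioo, ← intervalIntegral.integral_of_le hu,
      intervalIntegral.integral_const_mul, h, sub_add_cancel, Real.zero_rpow (by linarith)]
    congr 1
    field_simp
    ring
  · have := (hi.const_mul p)
    rw [intervalIntegrable_iff_integrableOn_Ioo_of_le hu] at this
    exact this
  · filter_upwards [ae_restrict_mem measurableSet_Ioo] with s hs
    have := hs.1
    simp only [Pi.zero_apply]
    positivity

lemma aux_kap_of_inter {p : ℝ} (hp : 1 < p) {E : Set ℝ} (hE : MeasurableSet E) {u v : ℝ}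
    (hu : 0 < u) (hv : 0 ≤ v) (h : (E ∩ Ioo 0 u : Set ℝ) =ᵐ[volume] Ioo 0 v) :
    auxKap p E u = ENNReal.ofReal ((v / u) ^ p) := by
  unfold auxKap
  have : ∀ s, ENNReal.ofReal (p * s ^ (p - 1)) * E.indicator (fun _ => (1 : ℝ≥0∞)) s =
      E.indicator (fun s => ENNReal.ofReal (p * s ^ (p - 1))) s := by
    intro s
    by_cases hs : s ∈ E <;> simp [hs]
  simp_rw [this]
  rw [setLIntegral_indicator hE, setLIntegral_congr h, aux_pow_int hp hv,
    ← ENNReal.ofReal_mul (by positivity), Real.div_rpow hv hu.le, Real.rpow_neg hu.le]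
  congr 1
  ring

lemma aux_E_cases {E : Set ℝ} (hE0 : E ⊆ Ioi 0) (hE : ∀ x ∈ E, ∀ y, 0 < y → y ≤ x → y ∈ E) :
    E = ∅ ∨ E = Ioi 0 ∨ ∃ σ, 0 < σ ∧ Ioo 0 σ ⊆ E ∧ E ⊆ Ioc 0 σ := by
  rcases E.eq_empty_or_nonempty with h | ⟨x, hx⟩
  · exact Or.inl h
  right
  by_cases hb : BddAbove E
  · right
    refine ⟨sSup E, (hE0 hx).trans_le (le_csSup hb hx), ?_, fun y hy => ⟨hE0 hy, le_csSup hb hy⟩⟩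
    intro y hy
    obtain ⟨z, hz, hyz⟩ := exists_lt_of_lt_csSup ⟨x, hx⟩ hy.2
    exact hE z hz y hy.1 hyz.le
  · left
    refine Subset.antisymm hE0 fun y hy => ?_
    rw [not_bddAbove_iff] at hb
    obtain ⟨z, hz, hyz⟩ := hb y
    exact hE z hz y hy hyz.le

lemma aux_kap_empty (p u : ℝ) : auxKap p ∅ u = 0 := by
  simp [auxKap]

lemma aux_kap_Ioi {p : ℝ} (hp : 1 < p) {u : ℝ} (hu : 0 < u) : auxKap p (Ioi 0) u = 1 := by
  rw [aux_kap_of_inter hp measurableSet_Ioi hu hu.le (by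
    rw [inter_eq_right.mpr Ioo_subset_Ioi_self]; exact EventuallyEq.refl _ _), div_self hu.ne', Real.one_rpow,
    ENNReal.ofReal_one]

lemma aux_kap_sigma {p : ℝ} (hp : 1 < p) {E : Set ℝ} (hEm : MeasurableSet E) {σ : ℝ} (hσ : 0 < σ)
    (h1 : Ioo 0 σ ⊆ E) (h2 : E ⊆ Ioc 0 σ) {u : ℝ} (hu : 0 < u) :
    auxKap p E u = auxKern p σ u := by
  rw [aux_kap_of_inter hp hEm hu (v := min u σ) (by positivity)]
  · rfl
  · have hEae : E =ᵐ[volume] Ioo 0 σ := by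
      refine (LE.le.eventuallyLE h2).trans_eq Ioo_ae_eq_Ioc.symm |>.antisymm
        (LE.le.eventuallyLE h1)
    have := hEae.inter (EventuallyEq.refl (ae volume) (Ioo (0 : ℝ) u))
    rw [Ioo_inter_Ioo, max_self, min_comm] at this
    exact this

lemma aux_kern_dil (p σ : ℝ) {u t : ℝ} (ht : 0 < t) :
    auxKern p σ (u / t) = auxKern p (σ * t) u := by
  unfold auxKern
  congr 2
  rw [show σ = σ * t / t by field_simp, min_div_div_right ht.le]
  field_simp

/-- Comparison for a down-closed set. -/
lemma aux_set_compare {p : ℝ} (hp : 1 < p) (φ : ℝ → ℝ≥0∞) (hφ : Measurable φ) {t : ℝ} (ht : 0 < t)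
    (B : ℝ≥0∞) (hB : ∀ s, 0 < s → DPhi ⊤ p φ (s * t) ≤ B * DPhi ⊤ p φ s)
    {E : Set ℝ} (hEm : MeasurableSet E) (hE0 : E ⊆ Ioi 0)
    (hE : ∀ x ∈ E, ∀ y, 0 < y → y ≤ x → y ∈ E) :
    ∫⁻ u in Ioi (0 : ℝ), auxKap p E (u / t) * φ u ≤
      B * ∫⁻ u in Ioi (0 : ℝ), auxKap p E u * φ u := by
  rcases aux_E_cases hE0 hE with h | h | ⟨σ, hσ, h1, h2⟩
  · subst h
    simp [aux_kap_empty]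
  · subst h
    rw [setLIntegral_congr_fun (g := φ) measurableSet_Ioi (fun u hu => by
        beta_reduce; rw [aux_kap_Ioi hp (div_pos hu ht), one_mul]),
      setLIntegral_congr_fun (f := fun u => auxKap p (Ioi 0) u * φ u) (g := φ)
        measurableSet_Ioi (fun u hu => by
        beta_reduce; rw [aux_kap_Ioi hp hu, one_mul])]
    have hun : Ioi (0 : ℝ) = ⋃ n : ℕ, Ioo (0 : ℝ) (((n : ℝ) + 1) * t) := by
      ext x
      simp only [mem_Ioi, mem_iUnion, mem_Ioo]
      constructor
      · intro hx
        obtain ⟨n, hn⟩ := exists_nat_gt (x / t)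
        refine ⟨n, hx, ?_⟩
        rw [div_lt_iff₀ ht] at hn
        nlinarith
      · rintro ⟨n, hn, _⟩
        exact hn
    conv_lhs => rw [hun]
    rw [setLIntegral_iUnion_of_directed]
    · refine iSup_le fun n => ?_
      have hn : (0 : ℝ) < (n : ℝ) + 1 := by positivity
      calc ∫⁻ x in Ioo (0 : ℝ) (((n : ℝ) + 1) * t), φ x ≤ DPhi ⊤ p φ (((n : ℝ) + 1) * t) :=
            le_self_add
        _ ≤ B * DPhi ⊤ p φ ((n : ℝ) + 1) := hB _ hn
        _ ≤ B * ∫⁻ u in Ioi (0 : ℝ), φ u := by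
            gcongr
            rw [← aux_D_eq φ hφ hn]
            apply setLIntegral_mono' measurableSet_Ioi
            intro u hu
            have hu : 0 < u := hu
            apply mul_le_of_le_one_left zero_le
            unfold auxKern
            rw [ENNReal.ofReal_le_one]
            apply Real.rpow_le_one (by positivity) _ (by linarith)
            rw [div_le_one hu]
            exact min_le_left _ _
    · apply Monotone.directed_le
      intro m n hmn
      apply Ioo_subset_Ioo_right
      have : (m : ℝ) ≤ n := by exact_mod_cast hmn
      gcongr
  · rw [setLIntegral_congr_fun (g := fun u => auxKern p (σ * t) u * φ u) measurableSet_Ioi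
        (fun u hu => by
          beta_reduce; rw [aux_kap_sigma hp hEm hσ h1 h2 (div_pos hu ht), aux_kern_dil p σ ht]),
      setLIntegral_congr_fun (f := fun u => auxKap p E u * φ u)
        (g := fun u => auxKern p σ u * φ u) measurableSet_Ioi
        (fun u hu => by beta_reduce; rw [aux_kap_sigma hp hEm hσ h1 h2 hu]),
      aux_D_eq φ hφ (by positivity), aux_D_eq φ hφ hσ]
    exact hB σ hσ

/-- Superlevel sets of `g**^(p-1) g`. -/
def auxE (p : ℝ) (g : ℝ → ℝ≥0∞) (l : ℝ) : Set ℝ :=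
  {s | 0 < s ∧ ENNReal.ofReal l < Pavg g s ^ (p - 1) * g s}

lemma aux_Pavg_meas (g : ℝ → ℝ≥0∞) : Measurable (Pavg g) := by
  unfold Pavg
  have : Monotone fun t : ℝ => ∫⁻ s in Ioo (0 : ℝ) t, g s := fun a b hab =>
    lintegral_mono_set (Ioo_subset_Ioo_right hab)
  exact (ENNReal.measurable_ofReal.inv).mul this.measurable

lemma aux_m_meas (p : ℝ) {g : ℝ → ℝ≥0∞} (hg : Antitone g) :
    Measurable fun s => Pavg g s ^ (p - 1) * g s :=
  ((aux_Pavg_meas g).pow_const _).mul hg.measurable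

lemma aux_E_meas2 (p : ℝ) {g : ℝ → ℝ≥0∞} (hg : Antitone g) :
    MeasurableSet {q : ℝ × ℝ | q.2 ∈ auxE p g q.1} := by
  have hm := aux_m_meas p hg
  have h1 : MeasurableSet {q : ℝ × ℝ | 0 < q.2} := measurableSet_lt measurable_const measurable_snd
  have h2 : MeasurableSet {q : ℝ × ℝ | ENNReal.ofReal q.1 < Pavg g q.2 ^ (p - 1) * g q.2} :=
    measurableSet_lt (by fun_prop) (hm.comp measurable_snd)
  exact h1.inter h2

lemma aux_E_meas (p : ℝ) {g : ℝ → ℝ≥0∞} (hg : Antitone g) (l : ℝ) : MeasurableSet (auxE p g l) :=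
  (aux_E_meas2 p hg).preimage (measurable_prodMk_left (x := l))

lemma aux_layer (c : ℝ≥0∞) :
    ∫⁻ l in Ioi (0 : ℝ), {l : ℝ | ENNReal.ofReal l < c}.indicator (fun _ => 1) l = c := by
  have hm : MeasurableSet {l : ℝ | ENNReal.ofReal l < c} :=
    measurableSet_lt ENNReal.measurable_ofReal measurable_const
  rw [setLIntegral_indicator hm, setLIntegral_const, one_mul]
  by_cases hc : c = ⊤
  · have : {l : ℝ | ENNReal.ofReal l < c} = univ := by
      ext x; simp [hc]
    rw [this, univ_inter, Real.volume_Ioi, hc]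
  · have : {l : ℝ | ENNReal.ofReal l < c} ∩ Ioi 0 = Ioo 0 c.toReal := by
      ext x
      simp only [mem_inter_iff, mem_ofPred_eq, mem_Ioi, mem_Ioo]
      constructor
      · rintro ⟨h, hx⟩
        exact ⟨hx, (ENNReal.ofReal_lt_iff_lt_toReal hx.le hc).mp h⟩
      · rintro ⟨hx, h⟩
        exact ⟨(ENNReal.ofReal_lt_iff_lt_toReal hx.le hc).mpr h, hx⟩
    rw [this, Real.volume_Ioo, sub_zero, ENNReal.ofReal_toReal hc]

lemma aux_ind_meas2 (p : ℝ) {g : ℝ → ℝ≥0∞} (hg : Antitone g) :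
    Measurable fun q : ℝ × ℝ => (auxE p g q.1).indicator (fun _ => (1 : ℝ≥0∞)) q.2 := by
  have h1 : Measurable fun _ : ℝ × ℝ => (1 : ℝ≥0∞) := measurable_const
  exact h1.indicator (aux_E_meas2 p hg)

lemma aux_rep {g : ℝ → ℝ≥0∞} (hg : Antitone g) {p : ℝ} (hp : 1 < p)
    (hfin : ∀ u, ∫⁻ s in Ioo (0 : ℝ) u, g s ≠ ⊤) {u : ℝ} (hu : 0 < u) :
    Pavg g u ^ p = ∫⁻ l in Ioi (0 : ℝ), auxKap p (auxE p g l) u := by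
  have hmeas := aux_ind_meas2 p hg
  have hmk : Measurable fun s : ℝ => ENNReal.ofReal (p * s ^ (p - 1)) := by fun_prop
  have hm2 : Measurable fun q : ℝ × ℝ => ENNReal.ofReal (p * q.2 ^ (p - 1)) *
      (auxE p g q.1).indicator (fun _ => (1 : ℝ≥0∞)) q.2 :=
    (hmk.comp measurable_snd).mul hmeas
  unfold auxKap
  rw [lintegral_const_mul _ (Measurable.lintegral_prod_right' (f := fun q : ℝ × ℝ =>
      ENNReal.ofReal (p * q.2 ^ (p - 1)) *
      (auxE p g q.1).indicator (fun _ => (1 : ℝ≥0∞)) q.2) hm2),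
    lintegral_lintegral_swap hm2.aemeasurable]
  have h1 : Pavg g u ^ p = ENNReal.ofReal (u ^ (-p)) * (∫⁻ s in Ioo (0 : ℝ) u, g s) ^ p := by
    unfold Pavg
    rw [ENNReal.mul_rpow_of_nonneg _ _ (by linarith), ← ENNReal.ofReal_inv_of_pos hu,
      ENNReal.ofReal_rpow_of_nonneg (by positivity) (by linarith), Real.inv_rpow hu.le,
      Real.rpow_neg hu.le]
  rw [h1, aux_ftc hg hp hfin hu]
  congr 1
  apply setLIntegral_congr_fun measurableSet_Ioo
  intro s hs
  have hs0 : 0 < s := hs.1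
  have hms : Measurable fun l => (auxE p g l).indicator (fun _ => (1 : ℝ≥0∞)) s :=
    hmeas.comp (measurable_prodMk_right (y := s))
  dsimp only
  rw [lintegral_const_mul _ hms]
  have h2 : ∀ l, (auxE p g l).indicator (fun _ => (1 : ℝ≥0∞)) s =
      {l : ℝ | ENNReal.ofReal l < Pavg g s ^ (p - 1) * g s}.indicator (fun _ => 1) l := by
    intro l
    simp only [indicator, auxE, mem_ofPred_eq, hs0, true_and]
  simp_rw [h2]
  rw [aux_layer, ← aux_ofReal_mul_Pavg g hs0, ENNReal.mul_rpow_of_nonneg _ _ (by linarith),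
    ENNReal.ofReal_rpow_of_pos hs0, ENNReal.ofReal_mul (by linarith)]
  ring

lemma aux_kap_meas2 (p : ℝ) {g : ℝ → ℝ≥0∞} (hg : Antitone g) :
    Measurable fun q : ℝ × ℝ => auxKap p (auxE p g q.2) q.1 := by
  unfold auxKap
  have hmk : Measurable fun s : ℝ => ENNReal.ofReal (p * s ^ (p - 1)) := by fun_prop
  have hS : MeasurableSet {q : (ℝ × ℝ) × ℝ | q.2 ∈ Ioo 0 q.1.1} := by
    have h1 : MeasurableSet {q : (ℝ × ℝ) × ℝ | 0 < q.2} :=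
      measurableSet_lt measurable_const measurable_snd
    have h2 : MeasurableSet {q : (ℝ × ℝ) × ℝ | q.2 < q.1.1} :=
      measurableSet_lt measurable_snd (by fun_prop)
    exact h1.inter h2
  have hI : Measurable fun q : (ℝ × ℝ) × ℝ => (auxE p g q.1.2).indicator (fun _ => (1 : ℝ≥0∞)) q.2 :=
    (aux_ind_meas2 p hg).comp (g := fun q : (ℝ × ℝ) => (auxE p g q.1).indicator (fun _ => (1 : ℝ≥0∞)) q.2)
      (f := fun q : (ℝ × ℝ) × ℝ => (q.1.2, q.2)) (by fun_prop)
  have hJ := ((hmk.comp (measurable_snd (α := ℝ × ℝ))).mul hI).indicator hS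
  have hK := hJ.lintegral_prod_right' (ν := volume)
  refine Measurable.mul (by fun_prop) ?_
  convert hK using 2 with q
  rw [← lintegral_indicator measurableSet_Ioo]
  rfl

lemma aux_main {g : ℝ → ℝ≥0∞} (hg : Antitone g) {p : ℝ} (hp : 1 < p)
    (hfin : ∀ u, ∫⁻ s in Ioo (0 : ℝ) u, g s ≠ ⊤) (φ : ℝ → ℝ≥0∞) (hφ : Measurable φ)
    {t : ℝ} (ht : 0 < t) (B : ℝ≥0∞)
    (hB : ∀ s, 0 < s → DPhi ⊤ p φ (s * t) ≤ B * DPhi ⊤ p φ s) :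
    ∫⁻ u in Ioi (0 : ℝ), Pavg g (u / t) ^ p * φ u ≤
      B * ∫⁻ u in Ioi (0 : ℝ), Pavg g u ^ p * φ u := by
  have hk := aux_kap_meas2 p hg
  have gen : ∀ τ : ℝ, 0 < τ → ∫⁻ u in Ioi (0 : ℝ), Pavg g (u / τ) ^ p * φ u =
      ∫⁻ l in Ioi (0 : ℝ), ∫⁻ u in Ioi (0 : ℝ), auxKap p (auxE p g l) (u / τ) * φ u := by
    intro τ hτ
    have hk1 : Measurable fun q : ℝ × ℝ => auxKap p (auxE p g q.2) (q.1 / τ) :=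
      hk.comp (f := fun q : ℝ × ℝ => (q.1 / τ, q.2)) (by fun_prop)
    have hk2 : Measurable fun q : ℝ × ℝ => auxKap p (auxE p g q.2) (q.1 / τ) * φ q.1 :=
      hk1.mul (hφ.comp measurable_fst)
    rw [← lintegral_lintegral_swap hk2.aemeasurable]
    apply setLIntegral_congr_fun measurableSet_Ioi
    intro u hu
    have hk3 : Measurable fun l => auxKap p (auxE p g l) (u / τ) :=
      hk1.comp (measurable_prodMk_left (x := u))
    beta_reduce
    rw [aux_rep hg hp hfin (div_pos hu hτ), lintegral_mul_const _ hk3]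
  have g1 := gen 1 one_pos
  simp only [div_one] at g1
  rw [gen t ht, g1, ← lintegral_const_mul]
  · apply lintegral_mono
    intro l
    apply aux_set_compare hp φ hφ ht B hB (aux_E_meas p hg l) (fun x hx => hx.1)
    intro x hx y hy hyx
    refine ⟨hy, hx.2.trans_le ?_⟩
    have := hg hyx
    have := aux_Pavg_anti hg hy hyx
    have hp1 : 0 ≤ p - 1 := by linarith
    gcongr
  · have hk2 : Measurable fun q : ℝ × ℝ => auxKap p (auxE p g q.1) q.2 * φ q.2 :=
      (hk.comp measurable_swap).mul (hφ.comp measurable_snd)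
    exact hk2.lintegral_prod_right'

/-! ### Properties of the weight -/

lemma aux_phi_pos {φ : ℝ → ℝ≥0∞} {p : ℝ} (hφ : IsNontrivialWeight ⊤ p φ) {x : ℝ} (hx : 0 < x) :
    0 < φ x := (hφ.1.2.1 x ⟨hx, ENNReal.ofReal_lt_top⟩).1

lemma aux_D_ne_zero {φ : ℝ → ℝ≥0∞} {p : ℝ} (hφ : IsNontrivialWeight ⊤ p φ) {s : ℝ} (hs : 0 < s) :
    DPhi ⊤ p φ s ≠ 0 := by
  have h : 0 < intPhi φ s := by
    unfold intPhi
    rw [setLIntegral_pos_iff hφ.1.1]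
    have : Function.support φ ∩ Ioo 0 s = Ioo 0 s :=
      inter_eq_right.mpr fun x hx => (aux_phi_pos hφ hx.1).ne'
    rw [this, Real.volume_Ioo]
    simpa using hs
  exact (h.trans_le le_self_add).ne'

lemma aux_intPhi_top {φ : ℝ → ℝ≥0∞} {p : ℝ} (hφ : IsNontrivialWeight ⊤ p φ) {s r : ℝ}
    (hr : 0 < r) (h : intPhi φ s = ⊤) : intPhi φ r = ⊤ := by
  unfold intPhi at *
  have hun : Ioo (0 : ℝ) s ⊆ Ioo 0 r ∪ Icc r s := by
    intro x hx
    rcases lt_or_ge x r with h | h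
    · exact Or.inl ⟨hx.1, h⟩
    · exact Or.inr ⟨h, hx.2.le⟩
  have h1 := (lintegral_mono_set (μ := volume) (f := φ) hun).trans (lintegral_union_le _ _ _)
  rw [h, top_le_iff, ENNReal.add_eq_top] at h1
  exact h1.resolve_right (hφ.1.2.2 r s hr ENNReal.ofReal_lt_top).ne

lemma aux_tail_ne_top {φ : ℝ → ℝ≥0∞} {p : ℝ} (hp : 1 < p) (hφ : IsNontrivialWeight ⊤ p φ) {s : ℝ}
    (hs : 0 < s) : tailP ⊤ p φ s ≠ ⊤ := by
  rw [aux_tail_top]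
  have hun : Ioi s ⊆ Icc s 1 ∪ Ioi 1 := by
    intro x hx
    rcases le_or_gt x 1 with h | h
    · exact Or.inl ⟨le_of_lt hx, h⟩
    · exact Or.inr h
  refine ne_top_of_le_ne_top ?_ ((lintegral_mono_set hun).trans (lintegral_union_le _ _ _))
  refine ENNReal.add_ne_top.mpr ⟨?_, (hφ.2.1 rfl).ne⟩
  have : ∫⁻ x in Icc s 1, φ x * ENNReal.ofReal (x ^ (-p)) ≤
      ∫⁻ x in Icc s 1, φ x * ENNReal.ofReal (s ^ (-p)) := by
    apply setLIntegral_mono' measurableSet_Icc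
    intro x hx
    gcongr φ x * ENNReal.ofReal ?_
    exact Real.rpow_le_rpow_of_nonpos hs hx.1 (by linarith)
  refine ne_top_of_le_ne_top ?_ this
  rw [lintegral_mul_const _ hφ.1.1]
  exact ENNReal.mul_ne_top (hφ.1.2.2 s 1 hs ENNReal.ofReal_lt_top).ne ENNReal.ofReal_ne_top

lemma aux_fin_of_rho {φ : ℝ → ℝ≥0∞} {p : ℝ} (hp : 1 < p) (hφ : IsNontrivialWeight ⊤ p φ)
    {g : ℝ → ℝ≥0∞} (hN : ∫⁻ u in Ioi (0 : ℝ), Pavg g u ^ p * φ u ≠ ⊤) (u : ℝ) :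
    ∫⁻ s in Ioo (0 : ℝ) u, g s ≠ ⊤ := by
  intro hu
  apply hN
  have hu0 : 0 < u := by
    by_contra h
    rw [Ioo_eq_empty h] at hu
    simp at hu
  rw [← top_le_iff]
  calc (⊤ : ℝ≥0∞) = ∫⁻ v in Ioi u, ⊤ := by
        rw [setLIntegral_const, Real.volume_Ioi]; simp
    _ ≤ ∫⁻ v in Ioi u, Pavg g v ^ p * φ v := by
        apply setLIntegral_mono' measurableSet_Ioi
        intro v hv
        have hF : ∫⁻ s in Ioo (0 : ℝ) v, g s = ⊤ := by
          rw [← top_le_iff, ← hu]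
          exact lintegral_mono_set (Ioo_subset_Ioo_right (le_of_lt hv))
        have hP : Pavg g v = ⊤ := by
          unfold Pavg
          rw [hF, ENNReal.mul_top]
          simp
        rw [hP, ENNReal.top_rpow_of_pos (by linarith),
          ENNReal.top_mul (aux_phi_pos hφ (hu0.trans hv)).ne']
    _ ≤ _ := lintegral_mono_set (Ioi_subset_Ioi hu0.le)

lemma aux_exists_pos {f : ℝ → ℝ} (hf : ¬ f =ᵐ[mu0] 0) : ∃ s, 0 < s ∧ decRearr mu0 f s ≠ 0 := by
  by_contra! h
  apply hf
  -- for every `l > 0` and `s > 0`, the measure of `{l < |f|}` is at most `s`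
  have h1 : ∀ l : ℝ≥0∞, 0 < l → mu0 {x | l < (‖f x‖₊ : ℝ≥0∞)} = 0 := by
    intro l hl
    rw [← le_zero_iff]
    refine le_of_forall_gt_imp_ge_of_dense fun c hc => ?_
    obtain ⟨s, hs0, hsc⟩ := ENNReal.lt_iff_exists_nnreal_btwn.mp hc
    have hs0' : (0 : ℝ) < s := by exact_mod_cast hs0
    have := h s hs0'
    unfold decRearr at this
    have hlt : sInf {l : ℝ≥0∞ | mu0 {x | l < (‖f x‖₊ : ℝ≥0∞)} ≤ ENNReal.ofReal s} < l := by
      rw [this]; exact hl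
    obtain ⟨l', hl', hll⟩ := sInf_lt_iff.mp hlt
    refine le_trans (measure_mono ?_) (le_trans hl' ?_)
    · intro x hx
      exact hll.trans hx
    · rw [ENNReal.ofReal_coe_nnreal]
      exact hsc.le
  have h2 : ∀ᵐ x ∂mu0, ∀ n : ℕ, ¬ (((n : ℝ≥0∞) + 1)⁻¹ < (‖f x‖₊ : ℝ≥0∞)) := by
    rw [ae_all_iff]
    intro n
    rw [ae_iff]
    simp only [not_not]
    exact h1 _ (by simp)
  filter_upwards [h2] with x hx
  by_contra hfx
  have hfx' : (‖f x‖₊ : ℝ≥0∞) ≠ 0 := by simpa using hfx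
  obtain ⟨n, hn⟩ := ENNReal.exists_inv_nat_lt hfx'
  apply hx n
  refine lt_of_le_of_lt ?_ hn
  apply ENNReal.inv_le_inv.mpr
  exact le_self_add

lemma aux_h_le {p : ℝ} (hp : 1 < p) (φ : ℝ → ℝ≥0∞) (hφ : IsNontrivialWeight ⊤ p φ) {t : ℝ}
    (ht : 0 < t) : hRho p φ t ≤ ABoyd p φ t := by
  have hp0 : 0 < p := by linarith
  unfold hRho
  refine iSup_le fun f => iSup_le fun hfm => iSup_le fun hf0 => iSup_le fun hf => ?_
  by_cases htop : rhoGamma mu0 ⊤ p φ f = ⊤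
  · rw [htop]; simp
  have hN : ∫⁻ u in Ioi (0 : ℝ), Pavg (decRearr mu0 f) u ^ p * φ u ≠ ⊤ := by
    intro h
    apply htop
    unfold rhoGamma
    rw [aux_IbSet_top]
    change (∫⁻ u in Ioi (0 : ℝ), Pavg (decRearr mu0 f) u ^ p * φ u) ^ (1 / p) = ⊤
    rw [h, ENNReal.top_rpow_of_pos (by positivity)]
  have hg := aux_decRearr_anti f
  have hint : ∀ s, intPhi φ s ≠ ⊤ := by
    intro s hs
    obtain ⟨r, hr, hfr⟩ := aux_exists_pos hf
    apply hN
    rw [← top_le_iff]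
    calc (⊤ : ℝ≥0∞) = decRearr mu0 f r ^ p * intPhi φ r := by
          rw [aux_intPhi_top hφ hr hs, ENNReal.mul_top]
          simp [hfr, hp0.le]
      _ = ∫⁻ u in Ioo 0 r, decRearr mu0 f r ^ p * φ u := by
          rw [lintegral_const_mul _ hφ.1.1]; rfl
      _ ≤ ∫⁻ u in Ioo 0 r, Pavg (decRearr mu0 f) u ^ p * φ u := by
          apply setLIntegral_mono' measurableSet_Ioo
          intro u hu
          have : decRearr mu0 f r ≤ Pavg (decRearr mu0 f) u :=
            (hg hu.2.le).trans (aux_le_Pavg hg hu.1)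
          gcongr
      _ ≤ _ := lintegral_mono_set Ioo_subset_Ioi_self
  have hDtop : ∀ s, 0 < s → DPhi ⊤ p φ s ≠ ⊤ := fun s hs =>
    ENNReal.add_ne_top.mpr ⟨hint s, ENNReal.mul_ne_top ENNReal.ofReal_ne_top
      (aux_tail_ne_top hp hφ hs)⟩
  have hB : ∀ s, 0 < s → DPhi ⊤ p φ (s * t) ≤ ABoyd p φ t ^ p * DPhi ⊤ p φ s := by
    intro s hs
    rw [← ENNReal.div_le_iff (aux_D_ne_zero hφ hs) (hDtop s hs)]
    have h : (DPhi ⊤ p φ (s * t) / DPhi ⊤ p φ s) ^ (1 / p) ≤ ABoyd p φ t := by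
      rw [aux_A_eq p φ ht]
      exact le_iSup₂ (f := fun (s : ℝ) (_ : 0 < s) =>
        (DPhi ⊤ p φ (s * t) / DPhi ⊤ p φ s) ^ (1 / p)) s hs
    rwa [one_div, ENNReal.rpow_inv_le_iff hp0] at h
  have key := aux_main hg hp (aux_fin_of_rho hp hφ hN) φ hφ.1.1 ht _ hB
  apply ENNReal.div_le_of_le_mul
  have e1 : rhoGamma mu0 ⊤ p φ (fun s => f (s / t)) =
      (∫⁻ u in Ioi (0 : ℝ), Pavg (decRearr mu0 f) (u / t) ^ p * φ u) ^ (1 / p) := by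
    unfold rhoGamma
    rw [aux_IbSet_top]
    congr 1
    apply setLIntegral_congr_fun measurableSet_Ioi
    intro u hu
    beta_reduce
    rw [aux_avg_dil f ht hu]
  have e2 : rhoGamma mu0 ⊤ p φ f =
      (∫⁻ u in Ioi (0 : ℝ), Pavg (decRearr mu0 f) u ^ p * φ u) ^ (1 / p) := by
    unfold rhoGamma
    rw [aux_IbSet_top]
    rfl
  rw [e1, e2]
  refine (ENNReal.rpow_le_rpow key (by positivity)).trans_eq ?_
  rw [ENNReal.mul_rpow_of_nonneg _ _ (by positivity), ← ENNReal.rpow_mul,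
    mul_one_div_cancel hp0.ne', ENNReal.rpow_one]

theorem statement14 (p : ℝ) (hp : 1 < p) (φ : ℝ → ℝ≥0∞)
    (hφ : IsNontrivialWeight ⊤ p φ) :
    ∃ c C : ℝ, 0 < c ∧ 0 < C ∧ ∀ t : ℝ, 0 < t →
      (ENNReal.ofReal c * ABoyd p φ t ≤ hRho p φ t ∧
        hRho p φ t ≤ ENNReal.ofReal C * ABoyd p φ t) ∧
      (ENNReal.ofReal c * ABoyd p φ t ≤ MRho p φ t ∧
        MRho p φ t ≤ ENNReal.ofReal C * ABoyd p φ t) := by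
  refine ⟨1, 1, one_pos, one_pos, fun t ht => ?_⟩
  have hM := aux_M_eq hp φ hφ.1.1 ht
  have h1 := aux_M_le_h p φ ht
  have h2 := aux_h_le hp φ hφ ht
  rw [hM] at h1
  simp only [ENNReal.ofReal_one, one_mul]
  exact ⟨⟨h1, h2⟩, hM.ge, hM.le⟩

end
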